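/- arXiv:2109.01591 — 5 statements merged into one kernel-verified Lean document; each statement's English description precedes it below -/
import Mathlib

section
/- Let n, K be positive integers, let X be a nonempty finite subset of {0,1}^n with every x ∈ X nonzero, and for each i ∈ [n] let p_{i0},…,p_{iK} be nonnegative reals summing to 1. Let Θ be the set of probability distributions θ on {0,…,K}^n whose marginals satisfy P_θ(c̃_i = k) = p_{ik} for all i, k, let Z(c) = max_{x∈X} cᵀx, and let U(r) = max_{θ∈Θ} P_θ(Z(c̃) ≥ r) for an integer r with 1 ≤ r ≤ nK. Then U(r) equals the optimal value of the linear program: minimize λ + Σ_{i=1}^n Σ_{k=0}^K α_{ik} p_{ik} over variables λ, α_{ik}, v_i, and for each x ∈ X variables t_x, q_{i,x}, f_{i,l,x}, subject to: λ + Σ_{i=1}^n v_i ≥ 0; α_{ik} ≥ v_i for all i ∈ [n], k ∈ {0,…,K}; and for every x ∈ X (with b_x the smallest index i with x_i = 1): λ + t_x + Σ_{i=1}^n q_{i,x} ≥ 1; (1 − x_i)α_{ik} ≥ q_{i,x} for all i ∈ [n], k ∈ {0,…,K}; f_{n,l,x} ≥ t_x for all integers l with r ≤ l ≤ nK; (f_{i−1,l−k,x}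 + α_{ik})x_i + f_{i−1,l,x}(1 − x_i) ≥ f_{i,l,x} for all i ∈ {2,…,n}, k ∈ {0,…,K}, and integers l with k ≤ l ≤ nK; and f_{b_x,k,x} = α_{b_x,k} for all k ∈ {0,…,K}. -/
open Finset

/-- Strong duality for a finite moment problem: if `U` bounds `∑ c, θ c * g c` over all probability
vectors `θ` with barycentre `p`, then some affine majorant of `g` has value less than `U + ε`
at `p`. -/
theorem exists_affine_majorant_lt {ω E : Type*} [Fintype ω] [DecidableEq ω]
    [NormedAddCommGroup E] [NormedSpace ℝ E] (e : ω → E) (g : ω → ℝ) (p : E) {U ε : ℝ}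
    (hε : 0 < ε) (hne : ∃ θ ∈ stdSimplex ℝ ω, ∑ c, θ c • e c = p)
    (hU : ∀ θ ∈ stdSimplex ℝ ω, ∑ c, θ c • e c = p → ∑ c, θ c * g c ≤ U) :
    ∃ (φ : E →L[ℝ] ℝ) (lam : ℝ), (∀ c, g c ≤ lam + φ (e c)) ∧ lam + φ p < U + ε := by
  set L : (ω → ℝ) →ₗ[ℝ] E × ℝ := Fintype.linearCombination ℝ (fun c => (e c, g c)) with hL
  have hLapply : ∀ θ, L θ = (∑ c, θ c • e c, ∑ c, θ c * g c) := by
    intro θ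
    rw [hL, Fintype.linearCombination_apply]
    ext <;> simp [Prod.fst_sum, Prod.snd_sum]
  have hconv : Convex ℝ (L '' stdSimplex ℝ ω) := (convex_stdSimplex ℝ ω).linear_image L
  have hclosed : IsClosed (L '' stdSimplex ℝ ω) :=
    ((isCompact_stdSimplex ℝ ω).image L.continuous_of_finiteDimensional).isClosed
  have hnot : (p, U + ε) ∉ L '' stdSimplex ℝ ω := by
    rintro ⟨θ, hθ, h⟩
    rw [hLapply, Prod.mk.injEq] at h
    have := hU θ hθ h.1
    linarith [h.2]
  obtain ⟨ψ, u, hψ, hu⟩ := geometric_hahn_banach_closed_point hconv hclosed hnot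
  have hsplit : ∀ y z, ψ (y, z) = ψ (y, 0) + z * ψ (0, 1) := by
    intro y z
    rw [← smul_eq_mul, ← map_smul, ← map_add]
    simp
  obtain ⟨θ, hθ, hθp⟩ := hne
  have hs : 0 < ψ (0, 1) := by
    have h1 := hψ _ ⟨θ, hθ, rfl⟩
    rw [hLapply, hθp, hsplit] at h1
    rw [hsplit] at hu
    have h2 := hU θ hθ hθp
    by_contra hneg
    nlinarith
  have hvert : ∀ c, ψ (e c, 0) + g c * ψ (0, 1) < u := by
    intro c
    have h1 := hψ _ ⟨Pi.single c 1, single_mem_stdSimplex ℝ c, rfl⟩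
    rw [hL, Fintype.linearCombination_apply_single, one_smul, hsplit] at h1
    exact h1
  refine ⟨-(ψ (0, 1))⁻¹ • ψ.comp (ContinuousLinearMap.inl ℝ E ℝ), (ψ (0, 1))⁻¹ * u,
    fun c => ?_, ?_⟩
  · have h1 := mul_le_mul_of_nonneg_left (hvert c).le (inv_nonneg.2 hs.le)
    have h2 : (ψ (0, 1))⁻¹ * (g c * ψ (0, 1)) = g c := by field_simp
    simp
    linarith
  · rw [hsplit] at hu
    have h1 := mul_lt_mul_of_pos_left hu (inv_pos.2 hs)
    have h2 : (ψ (0, 1))⁻¹ * ((U + ε) * ψ (0, 1)) = U + ε := by field_simp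
    simp
    linarith

/-- The product distribution has the prescribed marginals. -/
theorem sum_prod_filter_eq {ι κ : Type*} [Fintype ι] [DecidableEq ι] [Fintype κ] [DecidableEq κ]
    (p : ι → κ → ℝ) (hp : ∀ i, ∑ k, p i k = 1) (i : ι) (k : κ) :
    ∑ c ∈ univ.filter (fun c : ι → κ => c i = k), ∏ j, p j (c j) = p i k := by
  have hset : univ.filter (fun c : ι → κ => c i = k)
      = Fintype.piFinset (fun j => if j = i then {k} else univ) := by
    ext c
    simp only [mem_filter, mem_univ, true_and, Fintype.mem_piFinset]
    constructor
    · intro h j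
      split_ifs with hj
      · subst hj; simpa using h
      · simp
    · intro h
      simpa using h i
  rw [hset, ← Finset.prod_univ_sum, Finset.prod_eq_single i]
  · simp
  · intro j _ hj
    simp [hj, hp]
  · simp

theorem sum_prod_eq_one {ι κ : Type*} [Fintype ι] [DecidableEq ι] [Fintype κ]
    (p : ι → κ → ℝ) (hp : ∀ i, ∑ k, p i k = 1) : ∑ c : ι → κ, ∏ j, p j (c j) = 1 := by
  rw [← Fintype.piFinset_univ, Finset.sum_prod_piFinset]
  simp [hp]

/-- Strong duality between couplings with marginals `p` and additively separable majorants. -/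
theorem exists_separable_majorant_lt {ι κ : Type*} [Fintype ι] [DecidableEq ι] [Fintype κ]
    [DecidableEq κ] (p : ι → κ → ℝ) (hp0 : ∀ i k, 0 ≤ p i k) (hp1 : ∀ i, ∑ k, p i k = 1)
    (g : (ι → κ) → ℝ) {U ε : ℝ} (hε : 0 < ε)
    (hU : ∀ θ : (ι → κ) → ℝ, (∀ c, 0 ≤ θ c) → ∑ c, θ c = 1 →
      (∀ i k, ∑ c ∈ univ.filter (fun c : ι → κ => c i = k), θ c = p i k) →
      ∑ c, θ c * g c ≤ U) :
    ∃ (lam : ℝ) (α : ι → κ → ℝ), (∀ c, g c ≤ lam + ∑ i, α i (c i)) ∧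
      lam + ∑ i, ∑ k, α i k * p i k < U + ε := by
  have hmarg : ∀ θ : (ι → κ) → ℝ,
      (∑ c, θ c • (fun i => Pi.single (c i) (1 : ℝ) : ι → κ → ℝ) = p) ↔
      ∀ i k, ∑ c ∈ univ.filter (fun c : ι → κ => c i = k), θ c = p i k := by
    intro θ
    simp only [funext_iff, Finset.sum_apply, Pi.smul_apply, Pi.single_apply, smul_eq_mul,
      mul_ite, mul_one, mul_zero, Finset.sum_filter, eq_comm]
  obtain ⟨φ, lam, hφ, hlt⟩ := exists_affine_majorant_lt
    (fun c : ι → κ => (fun i => Pi.single (c i) (1 : ℝ) : ι → κ → ℝ)) g p hε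
    ⟨fun c => ∏ j, p j (c j), ⟨fun c => prod_nonneg fun j _ => hp0 _ _, sum_prod_eq_one p hp1⟩,
      (hmarg _).2 (sum_prod_filter_eq p hp1)⟩
    (fun θ hθ h => hU θ hθ.1 hθ.2 ((hmarg θ).1 h))
  have hrep : ∀ y : ι → κ → ℝ,
      φ y = ∑ i, ∑ k, φ (Pi.single i (Pi.single k 1)) * y i k := by
    intro y
    have hy : y = ∑ i, ∑ k, y i k • (Pi.single i (Pi.single k 1) : ι → κ → ℝ) := by
      ext i k
      simp [Finset.sum_apply, Pi.single_apply, apply_ite, ite_apply]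
    conv_lhs => rw [hy]
    simp [map_sum, mul_comm]
  refine ⟨lam, fun i k => φ (Pi.single i (Pi.single k 1)), fun c => ?_, ?_⟩
  · have := hφ c
    rw [hrep] at this
    simpa [Pi.single_apply] using this
  · rwa [hrep p] at hlt

/-- Weak duality between couplings with marginals `p` and additively separable majorants. -/
theorem sum_mul_le_of_separable_majorant {ι κ : Type*} [Fintype ι] [DecidableEq ι] [Fintype κ]
    [DecidableEq κ] {p : ι → κ → ℝ} {g θ : (ι → κ) → ℝ} (hθ0 : ∀ c, 0 ≤ θ c)
    (hθ1 : ∑ c, θ c = 1)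
    (hθp : ∀ i k, ∑ c ∈ univ.filter (fun c : ι → κ => c i = k), θ c = p i k)
    {lam : ℝ} {α : ι → κ → ℝ} (h : ∀ c, g c ≤ lam + ∑ i, α i (c i)) :
    ∑ c, θ c * g c ≤ lam + ∑ i, ∑ k, α i k * p i k := by
  have hα : ∀ i, ∑ k, α i k * p i k = ∑ c, θ c * α i (c i) := by
    intro i
    rw [← Finset.sum_fiberwise univ (fun c : ι → κ => c i)]
    refine Finset.sum_congr rfl fun k _ => ?_
    rw [← hθp i k, Finset.mul_sum]
    refine Finset.sum_congr rfl fun c hc => ?_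
    rw [(mem_filter.1 hc).2, mul_comm]
  calc ∑ c, θ c * g c ≤ ∑ c, θ c * (lam + ∑ i, α i (c i)) :=
        Finset.sum_le_sum fun c _ => mul_le_mul_of_nonneg_left (h c) (hθ0 c)
    _ = lam + ∑ i, ∑ k, α i k * p i k := by
        simp only [hα, mul_add, Finset.sum_add_distrib, ← Finset.sum_mul, hθ1, one_mul]
        rw [Finset.sum_comm]
        simp only [Finset.mul_sum]

theorem sum_filter_le_eq_add {n : ℕ} {M : Type*} [AddCommMonoid M] (a : Fin n → M) (i : Fin n)
    (hi : 1 ≤ (i : ℕ)) :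
    ∑ j ∈ univ.filter (fun j : Fin n => (j : ℕ) ≤ i), a j =
      ∑ j ∈ univ.filter (fun j : Fin n => (j : ℕ) ≤ (i : ℕ) - 1), a j + a i := by
  have hset : univ.filter (fun j : Fin n => (j : ℕ) ≤ i)
      = insert i (univ.filter (fun j : Fin n => (j : ℕ) ≤ (i : ℕ) - 1)) := by
    ext j
    simp only [mem_filter, mem_univ, true_and, mem_insert, Fin.ext_iff]
    omega
  rw [hset, Finset.sum_insert (by simp; omega), add_comm]

theorem sum_filter_le_eq_of_first {n : ℕ} {M : Type*} [AddCommMonoid M] (a : Fin n → M)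
    (b : Fin n) (hb : ∀ j, j < b → a j = 0) :
    ∑ j ∈ univ.filter (fun j : Fin n => (j : ℕ) ≤ b), a j = a b := by
  refine Finset.sum_eq_single b (fun j hj hjb => hb j ?_) (by simp)
  exact lt_of_le_of_ne (Fin.le_def.2 (mem_filter.1 hj).2) hjb

theorem sum_filter_le_last {n : ℕ} {M : Type*} [AddCommMonoid M] (a : Fin n → M) :
    ∑ j ∈ univ.filter (fun j : Fin n => (j : ℕ) ≤ n - 1), a j = ∑ j, a j := by
  rw [Finset.filter_true_of_mem]
  intro j _
  omega

/-- The total weight selected by `x` is at most `n * K`. -/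
theorem sum_selected_le {n K : ℕ} (x : Fin n → Bool) (c : Fin n → Fin (K + 1))
    (s : Finset (Fin n)) : ∑ j ∈ s, (if x j then (c j : ℕ) else 0) ≤ n * K := by
  calc ∑ j ∈ s, (if x j then (c j : ℕ) else 0) ≤ ∑ _j ∈ s, K :=
        Finset.sum_le_sum fun j _ => by split_ifs <;> omega
    _ ≤ n * K := by
        rw [Finset.sum_const, smul_eq_mul]
        exact Nat.mul_le_mul_right _ ((card_le_univ s).trans_eq (Fintype.card_fin n))

/-- Any solution of the dynamic-programming inequalities is bounded above by the cost of every
path, from the first selected coordinate `b` on. -/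
theorem dp_le_path_cost {n K : ℕ} {x : Fin n → Bool} {α : Fin n → Fin (K + 1) → ℝ}
    {f : Fin n → ℕ → ℝ}
    (hstep : ∀ i : Fin n, ∀ _hi : 1 ≤ (i : ℕ), ∀ k : Fin (K + 1), ∀ l : ℕ,
      (k : ℕ) ≤ l → l ≤ n * K →
      f i l ≤ (f ⟨(i : ℕ) - 1, lt_of_le_of_lt (Nat.sub_le _ _) i.isLt⟩ (l - (k : ℕ)) + α i k)
          * (if x i then (1 : ℝ) else 0)
        + f ⟨(i : ℕ) - 1, lt_of_le_of_lt (Nat.sub_le _ _) i.isLt⟩ l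
          * (1 - (if x i then (1 : ℝ) else 0)))
    {b : Fin n} (hb : x b = true) (hbmin : ∀ j, j < b → x j = false)
    (hinit : ∀ k : Fin (K + 1), f b (k : ℕ) = α b k) (c : Fin n → Fin (K + 1)) :
    ∀ m : ℕ, (b : ℕ) ≤ m → ∀ hm : m < n,
      f ⟨m, hm⟩ (∑ j ∈ univ.filter (fun j : Fin n => (j : ℕ) ≤ m), if x j then (c j : ℕ) else 0)
        ≤ ∑ j ∈ univ.filter (fun j : Fin n => (j : ℕ) ≤ m), if x j then α j (c j) else 0 := by
  intro m hbm
  induction m, hbm using Nat.le_induction with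
  | base =>
    intro hm
    rw [sum_filter_le_eq_of_first _ b (fun j hj => by simp [hbmin j hj]),
      sum_filter_le_eq_of_first _ b (fun j hj => by simp [hbmin j hj])]
    simp [hb, hinit]
  | succ m hbm ih =>
    intro hm
    have ih := ih (by omega)
    have hS := sum_filter_le_eq_add (fun j => if x j then (c j : ℕ) else 0) ⟨m + 1, hm⟩ (by simp)
    have hA := sum_filter_le_eq_add (fun j => if x j then α j (c j) else 0) ⟨m + 1, hm⟩ (by simp)
    simp only [Nat.add_sub_cancel] at hS hA
    rw [hA]
    have hle := sum_selected_le x c (univ.filter (fun j : Fin n => (j : ℕ) ≤ m + 1))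
    rw [hS] at hle ⊢
    cases hx : x ⟨m + 1, hm⟩ with
    | true =>
      simp only [hx, if_true] at hle ⊢
      have h := hstep ⟨m + 1, hm⟩ (by simp) (c ⟨m + 1, hm⟩) _ (Nat.le_add_left _ _) hle
      simp only [hx, if_true, Nat.add_sub_cancel] at h
      linarith
    | false =>
      simp only [hx, Bool.false_eq_true, if_false, add_zero] at hle ⊢
      have h := hstep ⟨m + 1, hm⟩ (by simp) 0 _ (Nat.zero_le _) hle
      simp only [hx, Bool.false_eq_true, if_false, Nat.add_sub_cancel] at h
      linarith

/-- The value function of the dynamic program, in which missing the target weight `l` is penalised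
at rate `M`. -/
noncomputable def penalizedValue {n K : ℕ} (α : Fin n → Fin (K + 1) → ℝ) (M : ℝ) (i : Fin n)
    (l : ℕ) (x : Fin n → Bool) : ℝ :=
  univ.inf' univ_nonempty fun c : Fin n → Fin (K + 1) =>
    (∑ j ∈ univ.filter (fun j : Fin n => (j : ℕ) ≤ i), if x j then α j (c j) else 0) +
      M * |(l : ℝ) -
        ((∑ j ∈ univ.filter (fun j : Fin n => (j : ℕ) ≤ i), if x j then (c j : ℕ) else 0 : ℕ) : ℝ)|

theorem penalizedValue_le {n K : ℕ} (α : Fin n → Fin (K + 1) → ℝ) (M : ℝ) (i : Fin n) (l : ℕ)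
    (x : Fin n → Bool) (c : Fin n → Fin (K + 1)) :
    penalizedValue α M i l x ≤
      (∑ j ∈ univ.filter (fun j : Fin n => (j : ℕ) ≤ i), if x j then α j (c j) else 0) +
      M * |(l : ℝ) -
        ((∑ j ∈ univ.filter (fun j : Fin n => (j : ℕ) ≤ i),
          if x j then (c j : ℕ) else 0 : ℕ) : ℝ)| :=
  Finset.inf'_le _ (mem_univ c)

theorem exists_penalizedValue_eq {n K : ℕ} (α : Fin n → Fin (K + 1) → ℝ) (M : ℝ) (i : Fin n)
    (l : ℕ) (x : Fin n → Bool) :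
    ∃ c : Fin n → Fin (K + 1),
      penalizedValue α M i l x =
        (∑ j ∈ univ.filter (fun j : Fin n => (j : ℕ) ≤ i), if x j then α j (c j) else 0) +
        M * |(l : ℝ) -
          ((∑ j ∈ univ.filter (fun j : Fin n => (j : ℕ) ≤ i),
            if x j then (c j : ℕ) else 0 : ℕ) : ℝ)| := by
  obtain ⟨c, -, hc⟩ := Finset.exists_mem_eq_inf' (s := univ) univ_nonempty
    fun c : Fin n → Fin (K + 1) =>
      (∑ j ∈ univ.filter (fun j : Fin n => (j : ℕ) ≤ i), if x j then α j (c j) else 0) +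
        M * |(l : ℝ) -
          ((∑ j ∈ univ.filter (fun j : Fin n => (j : ℕ) ≤ i),
            if x j then (c j : ℕ) else 0 : ℕ) : ℝ)|
  exact ⟨c, hc⟩

theorem penalizedValue_step {n K : ℕ} (α : Fin n → Fin (K + 1) → ℝ) (M : ℝ) (x : Fin n → Bool)
    (i : Fin n) (hi : 1 ≤ (i : ℕ)) (k : Fin (K + 1)) (l : ℕ) (hkl : (k : ℕ) ≤ l) :
    penalizedValue α M i l x ≤
      (penalizedValue α M ⟨(i : ℕ) - 1, lt_of_le_of_lt (Nat.sub_le _ _) i.isLt⟩ (l - (k : ℕ)) x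
          + α i k) * (if x i then (1 : ℝ) else 0)
        + penalizedValue α M ⟨(i : ℕ) - 1, lt_of_le_of_lt (Nat.sub_le _ _) i.isLt⟩ l x *
            (1 - (if x i then (1 : ℝ) else 0)) := by
  cases hx : x i with
  | true =>
    obtain ⟨c, hc⟩ := exists_penalizedValue_eq α M
      ⟨(i : ℕ) - 1, lt_of_le_of_lt (Nat.sub_le _ _) i.isLt⟩ (l - (k : ℕ)) x
    have h := penalizedValue_le α M i l x (Function.update c i k)
    rw [sum_filter_le_eq_add _ i hi, sum_filter_le_eq_add _ i hi] at h
    have hne : ∀ j ∈ univ.filter (fun j : Fin n => (j : ℕ) ≤ (i : ℕ) - 1), j ≠ i := by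
      rintro j hj rfl
      have := (mem_filter.1 hj).2
      omega
    rw [Finset.sum_congr rfl (g := fun j => if x j then α j (c j) else 0)
        (fun j hj => by rw [Function.update_of_ne (hne j hj)]),
      Finset.sum_congr rfl (g := fun j => if x j then (c j : ℕ) else 0)
        (fun j hj => by rw [Function.update_of_ne (hne j hj)])] at h
    simp only [hx, if_true, Function.update_self] at h ⊢
    rw [hc]
    push_cast [Nat.cast_sub hkl] at h ⊢
    rw [show ∀ a b c : ℝ, a - (b + c) = a - c - b by intros; ring] at h
    linarith
  | false =>
    obtain ⟨c, hc⟩ := exists_penalizedValue_eq α M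
      ⟨(i : ℕ) - 1, lt_of_le_of_lt (Nat.sub_le _ _) i.isLt⟩ l x
    have h := penalizedValue_le α M i l x c
    rw [sum_filter_le_eq_add _ i hi, sum_filter_le_eq_add _ i hi] at h
    simp only [hx, Bool.false_eq_true, if_false, add_zero] at h ⊢
    linarith

theorem penalizedValue_first {n K : ℕ} (α : Fin n → Fin (K + 1) → ℝ) {M : ℝ} (hM0 : 0 ≤ M)
    (hM : ∀ i k k', α i k - α i k' ≤ M) {x : Fin n → Bool} {b : Fin n} (hb : x b = true)
    (hbmin : ∀ j, j < b → x j = false) (k : Fin (K + 1)) :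
    penalizedValue α M b (k : ℕ) x = α b k := by
  apply le_antisymm
  · have h := penalizedValue_le α M b k x (fun _ => k)
    rw [sum_filter_le_eq_of_first _ b (fun j hj => by simp [hbmin j hj]),
      sum_filter_le_eq_of_first _ b (fun j hj => by simp [hbmin j hj])] at h
    simpa [hb] using h
  · obtain ⟨c, hc⟩ := exists_penalizedValue_eq α M b k x
    rw [sum_filter_le_eq_of_first _ b (fun j hj => by simp [hbmin j hj]),
      sum_filter_le_eq_of_first _ b (fun j hj => by simp [hbmin j hj])] at hc
    simp only [hb, if_true] at hc
    rw [hc]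
    by_cases hk : k = c b
    · simp [← hk]
    · have h1 : (1 : ℝ) ≤ |((k : ℕ) : ℝ) - ((c b : ℕ) : ℝ)| := by
        have hz : (1 : ℤ) ≤ |((k : ℕ) : ℤ) - ((c b : ℕ) : ℤ)| := by
          apply Int.one_le_abs
          intro h
          exact hk (Fin.ext (by omega))
        exact_mod_cast hz
      nlinarith [hM b k (c b), mul_le_mul_of_nonneg_left h1 hM0]

/-- If `α` together with `lam` majorises the indicator of weight at least `r` under `x`, then
the terminal values at targets `l ≥ r` satisfy the covering inequality. -/
theorem one_le_penalizedValue_last {n K r : ℕ} (hn : 0 < n) {α : Fin n → Fin (K + 1) → ℝ}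
    {lam M : ℝ} (hM : 1 ≤ M) {x : Fin n → Bool}
    (h0 : ∀ c : Fin n → Fin (K + 1), 0 ≤ lam + ∑ i, α i (c i))
    (h1 : ∀ c : Fin n → Fin (K + 1), r ≤ (∑ i, if x i then (c i : ℕ) else 0) →
      1 ≤ lam + ∑ i, α i (c i))
    (a : Fin n → Fin (K + 1)) {l : ℕ} (hl : r ≤ l) :
    1 ≤ lam + penalizedValue α M ⟨n - 1, by omega⟩ l x
      + ∑ i, (1 - (if x i then (1 : ℝ) else 0)) * α i (a i) := by
  obtain ⟨c, hc⟩ := exists_penalizedValue_eq α M ⟨n - 1, by omega⟩ l x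
  simp only [sum_filter_le_last] at hc
  set d : Fin n → Fin (K + 1) := fun i => if x i then c i else a i with hd
  have hcost : ∑ i, α i (d i) = (∑ i, if x i then α i (c i) else 0)
      + ∑ i, (1 - (if x i then (1 : ℝ) else 0)) * α i (a i) := by
    rw [← Finset.sum_add_distrib]
    refine Finset.sum_congr rfl fun i _ => ?_
    cases hx : x i <;> simp [hd, hx]
  have hweight : (∑ i, if x i then (d i : ℕ) else 0) = ∑ i, if x i then (c i : ℕ) else 0 := by
    refine Finset.sum_congr rfl fun i _ => ?_
    cases hx : x i <;> simp [hd, hx]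
  rw [hc]
  by_cases hr : r ≤ ∑ i, if x i then (c i : ℕ) else 0
  · have h := h1 d (hweight ▸ hr)
    have := mul_nonneg (zero_le_one.trans hM)
      (abs_nonneg ((l : ℝ) - ((∑ i, if x i then (c i : ℕ) else 0 : ℕ) : ℝ)))
    linarith
  · have h := h0 d
    have hlt : (((∑ i, if x i then (c i : ℕ) else 0 : ℕ) : ℝ)) + 1 ≤ l := by
      exact_mod_cast (not_le.1 hr).trans_le hl
    have habs := le_abs_self ((l : ℝ) - ((∑ i, if x i then (c i : ℕ) else 0 : ℕ) : ℝ))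
    nlinarith

/-- For a compact 0/1 V-polytope `X ⊆ {0,1}^n` (every point nonzero) and marginals
supported on `{0,…,K}`, the tightest upper bound
`U(r) = max_{θ ∈ Θ} P_θ(Z(c̃) ≥ r)` equals the optimal value of the compact dual
linear program built from the dynamic-programming reformulation of the separation
problem. Here `f` is indexed by `i : Fin n` (coordinate `i+1` in 1-based notation),
`l ∈ {0,…,nK}` and `x ∈ X`, and `b` denotes the smallest index `i` with `x i = true`. -/
theorem extremal_upper_bound_compact_LP (n K r : ℕ) (hn : 0 < n) (hK : 0 < K)
    (hr1 : 1 ≤ r) (hr2 : r ≤ n * K)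
    (X : Finset (Fin n → Bool)) (hX : X.Nonempty) (hX0 : ∀ x ∈ X, ∃ i, x i = true)
    (p : Fin n → Fin (K + 1) → ℝ) (hp0 : ∀ i k, 0 ≤ p i k) (hp1 : ∀ i, (∑ k, p i k) = 1) :
    sSup {P : ℝ | ∃ θ : (Fin n → Fin (K + 1)) → ℝ,
        (∀ c, 0 ≤ θ c) ∧ (∑ c, θ c) = 1 ∧
        (∀ i k, ∑ c ∈ univ.filter (fun c : Fin n → Fin (K + 1) => c i = k), θ c = p i k) ∧
        P = ∑ c ∈ univ.filter (fun c : Fin n → Fin (K + 1) =>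
              r ≤ X.sup' hX (fun x => ∑ i, if x i then (c i : ℕ) else 0)), θ c}
    = sInf {V : ℝ | ∃ (lam : ℝ) (α : Fin n → Fin (K + 1) → ℝ) (v : Fin n → ℝ)
        (t : (Fin n → Bool) → ℝ) (q : Fin n → (Fin n → Bool) → ℝ)
        (f : Fin n → ℕ → (Fin n → Bool) → ℝ),
        (0 ≤ lam + ∑ i, v i) ∧
        (∀ i k, v i ≤ α i k) ∧
        (∀ x ∈ X, 1 ≤ lam + t x + ∑ i, q i x) ∧
        (∀ x ∈ X, ∀ i, ∀ k, q i x ≤ (1 - (if x i then (1 : ℝ) else 0)) * α i k) ∧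
        (∀ x ∈ X, ∀ l : ℕ, r ≤ l → l ≤ n * K → t x ≤ f ⟨n - 1, by omega⟩ l x) ∧
        (∀ x ∈ X, ∀ i : Fin n, ∀ _hi : 1 ≤ (i : ℕ), ∀ k : Fin (K + 1), ∀ l : ℕ,
            (k : ℕ) ≤ l → l ≤ n * K →
            f i l x ≤
              (f ⟨(i : ℕ) - 1, lt_of_le_of_lt (Nat.sub_le _ _) i.isLt⟩ (l - (k : ℕ)) x
                  + α i k) * (if x i then (1 : ℝ) else 0)
                + f ⟨(i : ℕ) - 1, lt_of_le_of_lt (Nat.sub_le _ _) i.isLt⟩ l x *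
                    (1 - (if x i then (1 : ℝ) else 0))) ∧
        (∀ x ∈ X, ∀ b : Fin n, x b = true → (∀ j, j < b → x j = false) →
            ∀ k : Fin (K + 1), f b (k : ℕ) x = α b k) ∧
        V = lam + ∑ i, ∑ k, α i k * p i k} := by
  set g : (Fin n → Fin (K + 1)) → ℝ := fun c =>
    if r ≤ X.sup' hX (fun x => ∑ i, if x i then (c i : ℕ) else 0) then 1 else 0 with hg
  have hgsum : ∀ θ : (Fin n → Fin (K + 1)) → ℝ,
      ∑ c ∈ univ.filter (fun c : Fin n → Fin (K + 1) =>
        r ≤ X.sup' hX (fun x => ∑ i, if x i then (c i : ℕ) else 0)), θ c = ∑ c, θ c * g c := by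
    intro θ
    simp [hg, Finset.sum_filter]
  simp only [hgsum]
  set S : Set ℝ := {P : ℝ | ∃ θ : (Fin n → Fin (K + 1)) → ℝ,
    (∀ c, 0 ≤ θ c) ∧ (∑ c, θ c) = 1 ∧
    (∀ i k, ∑ c ∈ univ.filter (fun c : Fin n → Fin (K + 1) => c i = k), θ c = p i k) ∧
    P = ∑ c, θ c * g c}
  have hSne : S.Nonempty := ⟨_, fun c => ∏ j, p j (c j), fun c => prod_nonneg fun j _ => hp0 _ _,
    sum_prod_eq_one p hp1, sum_prod_filter_eq p hp1, rfl⟩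
  have hSbdd : BddAbove S := by
    refine ⟨1, ?_⟩
    rintro _ ⟨θ, hθ0, hθ1, -, rfl⟩
    rw [← hθ1]
    refine Finset.sum_le_sum fun c _ => mul_le_of_le_one_right (hθ0 c) ?_
    simp only [hg]
    split_ifs <;> norm_num
  have hgmaj : ∀ (lam : ℝ) (α : Fin n → Fin (K + 1) → ℝ),
      (∀ c, g c ≤ lam + ∑ i, α i (c i)) ↔
      (∀ c : Fin n → Fin (K + 1), 0 ≤ lam + ∑ i, α i (c i)) ∧
      ∀ x ∈ X, ∀ c : Fin n → Fin (K + 1), r ≤ (∑ i, if x i then (c i : ℕ) else 0) →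
        1 ≤ lam + ∑ i, α i (c i) := by
    intro lam α
    constructor
    · intro h
      refine ⟨fun c => le_trans ?_ (h c), fun x hx c hc => le_trans (le_of_eq ?_) (h c)⟩
      · simp only [hg]
        split_ifs <;> norm_num
      · simp only [hg]
        rw [if_pos ((Finset.le_sup'_iff hX).2 ⟨x, hx, hc⟩)]
    · rintro ⟨h0, h1⟩ c
      simp only [hg]
      split_ifs with hc
      · obtain ⟨x, hx, hxc⟩ := (Finset.le_sup'_iff hX).1 hc
        exact h1 x hx c hxc
      · exact h0 c
  refine Eq.trans (b := sInf {V : ℝ | ∃ (lam : ℝ) (α : Fin n → Fin (K + 1) → ℝ),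
    (∀ c, g c ≤ lam + ∑ i, α i (c i)) ∧ V = lam + ∑ i, ∑ k, α i k * p i k}) ?_
    (congrArg sInf (Eq.symm ?_))
  swap
  · ext V
    constructor
    · rintro ⟨lam, α, v, t, q, f, hv0, hv, hcov, hq, ht, hstep, hinit, hV⟩
      refine ⟨lam, α, (hgmaj lam α).2 ⟨fun c => ?_, fun x hx c hc => ?_⟩, hV⟩
      · have := Finset.sum_le_sum fun i (_ : i ∈ univ) => hv i (c i)
        linarith
      · obtain ⟨b, hb, hbmin⟩ : ∃ b : Fin n, x b = true ∧ ∀ j, j < b → x j = false := by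
          have hne : (univ.filter fun i => x i = true).Nonempty := by
            obtain ⟨i, hi⟩ := hX0 x hx
            exact ⟨i, by simpa using hi⟩
          refine ⟨_, (mem_filter.1 (Finset.min'_mem _ hne)).2, fun j hj => ?_⟩
          by_contra hxj
          exact absurd (Finset.min'_le _ j (by simpa using hxj)) (not_le.2 hj)
        have hpath := dp_le_path_cost (f := fun i l => f i l x) (hstep x hx) hb hbmin
          (hinit x hx b hb hbmin) c (n - 1) (by omega) (by omega)
        simp only [sum_filter_le_last] at hpath
        have htx := ht x hx _ hc (sum_selected_le x c univ)
        have hqx := Finset.sum_le_sum fun i (_ : i ∈ univ) => hq x hx i (c i)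
        have hsplit : ∑ i, α i (c i) = (∑ i, if x i then α i (c i) else 0)
            + ∑ i, (1 - (if x i then (1 : ℝ) else 0)) * α i (c i) := by
          rw [← Finset.sum_add_distrib]
          refine Finset.sum_congr rfl fun i _ => ?_
          cases x i <;> simp
        have := hcov x hx
        linarith
    · rintro ⟨lam, α, hmaj, hV⟩
      obtain ⟨h0, h1⟩ := (hgmaj lam α).1 hmaj
      choose a ha using fun i => Finite.exists_min (α i)
      choose a' ha' using fun (i : Fin n) (x : Fin n → Bool) =>
        Finite.exists_min fun k => (1 - (if x i then (1 : ℝ) else 0)) * α i k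
      obtain ⟨M, hM1, hM⟩ : ∃ M : ℝ, 1 ≤ M ∧ ∀ i k k', α i k - α i k' ≤ M := by
        obtain ⟨M, hM⟩ := (Set.finite_range
          fun z : Fin n × Fin (K + 1) × Fin (K + 1) => α z.1 z.2.1 - α z.1 z.2.2).bddAbove
        exact ⟨max 1 M, le_max_left _ _, fun i k k' =>
          le_max_of_le_right (hM ⟨(i, k, k'), rfl⟩)⟩
      refine ⟨lam, α, fun i => α i (a i),
        fun x => (Finset.Icc r (n * K)).inf' (Finset.nonempty_Icc.2 hr2)
          fun l => penalizedValue α M ⟨n - 1, by omega⟩ l x,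
        fun i x => (1 - (if x i then (1 : ℝ) else 0)) * α i (a' i x),
        penalizedValue α M, h0 a, ha, fun x hx => ?_, fun x _ i k => ha' i x k,
        fun x _ l hl hl' => Finset.inf'_le _ (Finset.mem_Icc.2 ⟨hl, hl'⟩),
        fun x _ i hi k l hkl _ => penalizedValue_step α M x i hi k l hkl,
        fun x _ b hb hbmin k => penalizedValue_first α (by linarith) hM hb hbmin k, hV⟩
      obtain ⟨l, hl, hlt⟩ := Finset.exists_mem_eq_inf' (Finset.nonempty_Icc.2 hr2)
        fun l => penalizedValue α M ⟨n - 1, by omega⟩ l x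
      beta_reduce
      rw [hlt]
      exact one_le_penalizedValue_last hn hM1 h0 (h1 x hx) (fun i => a' i x)
        (Finset.mem_Icc.1 hl).1
  have hstrong : ∀ ε : ℝ, 0 < ε → ∃ (lam : ℝ) (α : Fin n → Fin (K + 1) → ℝ),
      (∀ c, g c ≤ lam + ∑ i, α i (c i)) ∧ lam + ∑ i, ∑ k, α i k * p i k < sSup S + ε :=
    fun ε hε => exists_separable_majorant_lt p hp0 hp1 g hε
      fun θ hθ0 hθ1 hθp => le_csSup hSbdd ⟨θ, hθ0, hθ1, hθp, rfl⟩
  have hweak : ∀ P ∈ S, ∀ (lam : ℝ) (α : Fin n → Fin (K + 1) → ℝ),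
      (∀ c, g c ≤ lam + ∑ i, α i (c i)) → P ≤ lam + ∑ i, ∑ k, α i k * p i k := by
    rintro _ ⟨θ, hθ0, hθ1, hθp, rfl⟩ lam α h
    exact sum_mul_le_of_separable_majorant hθ0 hθ1 hθp h
  apply le_antisymm
  · refine csSup_le hSne fun P hP => le_csInf ?_ ?_
    · obtain ⟨lam, α, h, -⟩ := hstrong 1 one_pos
      exact ⟨_, lam, α, h, rfl⟩
    · rintro _ ⟨lam, α, h, rfl⟩
      exact hweak P hP lam α h
  · refine le_of_forall_pos_le_add fun ε hε => ?_
    obtain ⟨lam, α, h, hlt⟩ := hstrong ε hε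
    refine le_trans (csInf_le ?_ ⟨lam, α, h, rfl⟩) hlt.le
    obtain ⟨P, hP⟩ := hSne
    refine ⟨P, ?_⟩
    rintro _ ⟨lam, α, h, rfl⟩
    exact hweak P hP lam α h
end

section
/- Let n be a positive integer, r an integer with 1 ≤ r ≤ n, and p_1,…,p_n ∈ [0,1] with order statistics p_{(1)} ≤ p_{(2)} ≤ … ≤ p_{(n)}. Then the maximum over all joint probability distributions θ on {0,1}^n with P_θ(c̃_i = 1) = p_i of the probability P_θ(Σ_{i=1}^n c̃_i ≥ r) equals min( min_{t∈{0,…,r−1}} Σ_{i=1}^{n−t} p_{(i)}/(r − t), 1 ) (Rüger's bound). -/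
open Finset

/-- The points of the unit cube whose coordinates sum to at least `r`. -/
def cubeSlice (n r : ℕ) : Set (Fin n → ℝ) :=
  {x | (∀ i, x i ∈ Set.Icc (0 : ℝ) 1) ∧ (r : ℝ) ≤ ∑ i, x i}

/-- The 0/1 vector of a Boolean vector. -/
def boolPoint {n : ℕ} (c : Fin n → Bool) : Fin n → ℝ := fun i => if c i = true then 1 else 0

lemma convex_cubeSlice (n r : ℕ) : Convex ℝ (cubeSlice n r) := by
  rintro x ⟨hx, hxs⟩ y ⟨hy, hys⟩ a b ha hb hab
  refine ⟨fun i => convex_Icc (0 : ℝ) 1 (hx i) (hy i) ha hb hab, ?_⟩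
  simp only [Pi.add_apply, Pi.smul_apply, smul_eq_mul, sum_add_distrib, ← mul_sum]
  have h : (r : ℝ) = a * r + b * r := by rw [← add_mul, hab, one_mul]
  rw [h]
  gcongr

lemma isCompact_cubeSlice (n r : ℕ) : IsCompact (cubeSlice n r) := by
  have hcube : IsCompact (Set.univ.pi fun _ : Fin n => Set.Icc (0 : ℝ) 1) :=
    isCompact_univ_pi fun _ => isCompact_Icc
  have hclosed : IsClosed {x : Fin n → ℝ | (r : ℝ) ≤ ∑ i, x i} :=
    isClosed_le continuous_const (by fun_prop)
  convert hcube.inter_right hclosed using 1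
  ext x
  simp only [cubeSlice, Set.mem_ofPred_eq, Set.mem_inter_iff, Set.mem_univ_pi]

/-- An extreme point admits no nonzero direction in which one can move both ways. -/
lemma eq_zero_of_add_mem_of_sub_mem {E : Type*} [AddCommGroup E] [Module ℝ E] {K : Set E}
    {x d : E} (hx : x ∈ K.extremePoints ℝ) (hadd : x + d ∈ K) (hsub : x - d ∈ K) : d = 0 := by
  have hmem : x ∈ openSegment ℝ (x + d) (x - d) :=
    ⟨1 / 2, 1 / 2, by norm_num, by norm_num, by norm_num, by module⟩
  simpa using hx.2 hadd hsub hmem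

lemma sum_boolPoint {n : ℕ} (c : Fin n → Bool) :
    ∑ i, boolPoint c i = ((univ.filter fun i => c i = true).card : ℝ) := by
  simp [boolPoint]

lemma extremePoint_coord {n r : ℕ} {x : Fin n → ℝ}
    (hx : x ∈ (cubeSlice n r).extremePoints ℝ) (i : Fin n) : x i = 0 ∨ x i = 1 := by
  by_contra! hi
  obtain ⟨hcube, hsum⟩ := hx.1
  have hi0 : 0 < x i := lt_of_le_of_ne (hcube i).1 hi.1.symm
  have hi1 : x i < 1 := lt_of_le_of_ne (hcube i).2 hi.2
  by_cases hj : ∃ j, j ≠ i ∧ x j ≠ 0 ∧ x j ≠ 1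
  · obtain ⟨j, hji, hj0, hj1⟩ := hj
    have hj0 : 0 < x j := lt_of_le_of_ne (hcube j).1 hj0.symm
    have hj1 : x j < 1 := lt_of_le_of_ne (hcube j).2 hj1
    obtain ⟨ε, hε, hεlt⟩ : ∃ ε : ℝ, 0 < ε ∧ ε < min (min (x i) (1 - x i)) (min (x j) (1 - x j)) :=
      exists_between (by simp [*])
    simp only [lt_min_iff] at hεlt
    obtain ⟨⟨h1, h2⟩, h3, h4⟩ := hεlt
    have hd := eq_zero_of_add_mem_of_sub_mem hx
      (d := Pi.single i ε - Pi.single j ε) ⟨fun k => ?_, ?_⟩ ⟨fun k => ?_, ?_⟩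
    · have := congrFun hd i
      simp [hji.symm] at this
      exact hε.ne' this
    · have := hcube k
      rcases eq_or_ne k i with rfl | hki
      · simp [hji.symm]; constructor <;> linarith
      · rcases eq_or_ne k j with rfl | hkj
        · simp [hki]; constructor <;> linarith
        · simpa [hki, hkj] using this
    · simpa [sum_add_distrib, sum_sub_distrib] using hsum
    · have := hcube k
      rcases eq_or_ne k i with rfl | hki
      · simp [hji.symm]; constructor <;> linarith
      · rcases eq_or_ne k j with rfl | hkj
        · simp [hki]; constructor <;> linarith
        · simpa [hki, hkj] using this
    · simpa [sum_add_distrib, sum_sub_distrib] using hsum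
  · push Not at hj
    have hrest : ∑ j ∈ univ.erase i, x j =
        (((univ.erase i).filter fun j => x j = 1).card : ℝ) := by
      rw [card_filter, Nat.cast_sum]
      refine sum_congr rfl fun j hj' => ?_
      by_cases h : x j = 0
      · simp [h]
      · simp [hj j (ne_of_mem_erase hj') h]
    have hsplit : ∑ j, x j = x i + ∑ j ∈ univ.erase i, x j :=
      (add_sum_erase _ _ (mem_univ i)).symm
    have hr : (r : ℝ) ≤ ∑ j ∈ univ.erase i, x j := by
      rw [hrest]
      have : (r : ℝ) < (((univ.erase i).filter fun j => x j = 1).card : ℝ) + 1 := by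
        rw [← hrest]; linarith
      exact_mod_cast Nat.lt_succ_iff.mp (by exact_mod_cast this)
    obtain ⟨ε, hε, hεlt⟩ : ∃ ε : ℝ, 0 < ε ∧ ε < min (x i) (1 - x i) :=
      exists_between (by simp [*])
    simp only [lt_min_iff] at hεlt
    obtain ⟨h1, h2⟩ := hεlt
    have hd := eq_zero_of_add_mem_of_sub_mem hx
      (d := Pi.single i ε) ⟨fun k => ?_, ?_⟩ ⟨fun k => ?_, ?_⟩
    · have := congrFun hd i
      simp at this
      exact hε.ne' this
    · have := hcube k
      rcases eq_or_ne k i with rfl | hki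
      · simp; constructor <;> linarith
      · simpa [hki] using this
    · simp [sum_add_distrib]; linarith
    · have := hcube k
      rcases eq_or_ne k i with rfl | hki
      · simp; constructor <;> linarith
      · simpa [hki] using this
    · simp [sum_sub_distrib]; linarith

lemma cubeSlice_subset_convexHull (n r : ℕ) :
    cubeSlice n r ⊆ convexHull ℝ
      (boolPoint '' {c : Fin n → Bool | r ≤ (univ.filter fun i => c i = true).card}) := by
  rw [← closure_convexHull_extremePoints (isCompact_cubeSlice n r) (convex_cubeSlice n r)]
  refine closure_minimal (convexHull_mono fun x hx => ?_)
    ((Set.toFinite _).isClosed_convexHull ℝ)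
  have hbool : boolPoint (fun i => decide (x i = 1)) = x := by
    funext i
    rcases extremePoint_coord hx i with h | h <;> simp [boolPoint, h]
  refine ⟨_, ?_, hbool⟩
  have hsum := hx.1.2
  rw [← hbool, sum_boolPoint] at hsum
  exact_mod_cast hsum

/-- A vector in `[0, B]ⁿ` with coordinate sum at least `r * B` is the vector of marginals of a
measure of mass `B` carried by the Boolean vectors with at least `r` true coordinates. -/
lemma exists_measure_of_marginals {n : ℕ} (r : ℕ) {B : ℝ} (hB : 0 ≤ B) {q : Fin n → ℝ}
    (hq : ∀ i, q i ∈ Set.Icc 0 B) (hsum : r * B ≤ ∑ i, q i) :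
    ∃ w : (Fin n → Bool) → ℝ, (∀ c, 0 ≤ w c) ∧ ∑ c, w c = B ∧
      (∀ i, ∑ c ∈ univ.filter (fun c : Fin n → Bool => c i = true), w c = q i) ∧
      ∑ c ∈ univ.filter
        (fun c : Fin n → Bool => r ≤ (univ.filter (fun i => c i = true)).card), w c = B := by
  rcases hB.eq_or_lt with rfl | hB
  · exact ⟨0, by simp, by simp, fun i => by simpa using (le_antisymm (hq i).2 (hq i).1).symm,
      by simp⟩
  let D : Set (Fin n → ℝ) := {x | ∃ w : (Fin n → Bool) → ℝ, (∀ c, 0 ≤ w c) ∧ ∑ c, w c = 1 ∧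
      (∀ i, ∑ c ∈ univ.filter (fun c : Fin n → Bool => c i = true), w c = x i) ∧
      ∑ c ∈ univ.filter
        (fun c : Fin n → Bool => r ≤ (univ.filter (fun i => c i = true)).card), w c = 1}
  have hD : Convex ℝ D := by
    rintro x ⟨u, hu, hu1, hux, hur⟩ y ⟨v, hv, hv1, hvy, hvr⟩ a b ha hb hab
    refine ⟨fun c => a * u c + b * v c, fun c => ?_, ?_, fun i => ?_, ?_⟩
    · have := hu c
      have := hv c
      positivity
    · simp only [sum_add_distrib, ← mul_sum, hu1, hv1, mul_one, hab]
    · simp only [sum_add_distrib, ← mul_sum, hux, hvy, Pi.add_apply, Pi.smul_apply, smul_eq_mul]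
    · simp only [sum_add_distrib, ← mul_sum, hur, hvr, mul_one, hab]
  have hpoints : boolPoint ''
      {c : Fin n → Bool | r ≤ (univ.filter fun i => c i = true).card} ⊆ D := by
    rintro _ ⟨c, hc, rfl⟩
    refine ⟨Pi.single c 1, fun c' => ?_, by simp, fun i => ?_, ?_⟩
    · by_cases h : c' = c
      · subst h; simp
      · simp [h]
    · simp [boolPoint]
    · simpa using hc
  have hmem : (fun i => q i / B) ∈ cubeSlice n r := by
    refine ⟨fun i => ⟨div_nonneg (hq i).1 hB.le, (div_le_one hB).2 (hq i).2⟩, ?_⟩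
    rw [← sum_div, le_div_iff₀ hB]
    exact hsum
  obtain ⟨w, hw, hw1, hwq, hwr⟩ :=
    convexHull_min hpoints hD (cubeSlice_subset_convexHull n r hmem)
  refine ⟨fun c => B * w c, fun c => mul_nonneg hB.le (hw c), ?_, fun i => ?_, ?_⟩
  · rw [← mul_sum, hw1, mul_one]
  · rw [← mul_sum, hwq, mul_div_cancel₀ _ hB.ne']
  · rw [← mul_sum, hwr, mul_one]

/-- Markov's inequality for the number of true coordinates among those outside a set of
`t` indices. -/
lemma tail_mul_le_sum_marginals {n r t : ℕ} {θ : (Fin n → Bool) → ℝ} (hθ : ∀ c, 0 ≤ θ c)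
    {p : Fin n → ℝ}
    (hmarg : ∀ i, ∑ c ∈ univ.filter (fun c : Fin n → Bool => c i = true), θ c = p i)
    (s : Finset (Fin n)) (hs : sᶜ.card ≤ t) :
    (∑ c ∈ univ.filter
      (fun c : Fin n → Bool => r ≤ (univ.filter (fun i => c i = true)).card), θ c) *
      ((r : ℝ) - t) ≤ ∑ i ∈ s, p i := by
  have hswap : ∑ i ∈ s, p i = ∑ c, θ c * ((s.filter fun i => c i = true).card : ℝ) := by
    simp_rw [← hmarg, sum_filter]
    rw [sum_comm]
    refine sum_congr rfl fun c _ => ?_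
    rw [← sum_filter, sum_const, nsmul_eq_mul, mul_comm]
  rw [hswap, sum_mul]
  refine le_trans (sum_le_sum fun c hc => ?_) (sum_le_sum_of_subset_of_nonneg (subset_univ _)
    fun c _ _ => mul_nonneg (hθ c) (Nat.cast_nonneg _))
  refine mul_le_mul_of_nonneg_left ?_ (hθ c)
  have hcard : (univ.filter fun i => c i = true).card ≤
      (s.filter fun i => c i = true).card + sᶜ.card := by
    refine (card_le_card fun i hi => ?_).trans (card_union_le _ _)
    by_cases h : i ∈ s <;> simp_all
  have hr : r ≤ (s.filter fun i => c i = true).card + t :=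
    ((mem_filter.1 hc).2.trans hcard).trans (by omega)
  have : (r : ℝ) ≤ ((s.filter fun i => c i = true).card : ℝ) + t := by exact_mod_cast hr
  linarith

lemma card_compl_filter_val_lt (n t : ℕ) :
    (univ.filter fun i : Fin n => (i : ℕ) < n - t)ᶜ.card ≤ t := by
  rw [card_compl, Fin.card_filter_val_lt, Fintype.card_fin]
  omega

/-- The entries of a monotone vector that do not exceed `B` form an initial segment. -/
lemma le_iff_val_lt_of_monotone {n : ℕ} {f : Fin n → ℝ} (hf : Monotone f) (B : ℝ) (i : Fin n) :
    f i ≤ B ↔ (i : ℕ) < n - (univ.filter fun j => B < f j).card := by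
  constructor
  · intro h
    have hsub : (univ.filter fun j => B < f j) ⊆ Ioi i := fun j hj => by
      rw [mem_Ioi]
      by_contra! hji
      exact absurd ((mem_filter.1 hj).2.trans_le (hf hji)) h.not_gt
    have := card_le_card hsub
    rw [Fin.card_Ioi] at this
    omega
  · intro h
    by_contra! hi
    have hsub : Ici i ⊆ univ.filter fun j => B < f j := fun j hj =>
      mem_filter.2 ⟨mem_univ _, hi.trans_le (hf (mem_Ici.1 hj))⟩
    have := card_le_card hsub
    rw [Fin.card_Ici] at this
    omega

lemma mul_le_sum_min {n r : ℕ} {f : Fin n → ℝ} (hf : Monotone f) (hf0 : ∀ i, 0 ≤ f i) {B : ℝ}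
    (hB : 0 ≤ B)
    (hbound : ∀ t < r, B * ((r : ℝ) - t) ≤
      ∑ i ∈ univ.filter (fun i : Fin n => (i : ℕ) < n - t), f i) :
    r * B ≤ ∑ i, min (f i) B := by
  set t := (univ.filter fun j => B < f j).card
  have hlarge : ∑ i ∈ univ.filter (fun i => B < f i), min (f i) B = t * B := by
    rw [sum_congr rfl fun i hi => min_eq_right (mem_filter.1 hi).2.le, sum_const, nsmul_eq_mul]
  have hsplit := sum_filter_add_sum_filter_not univ (fun i => B < f i) fun i => min (f i) B
  rw [hlarge] at hsplit
  rcases lt_or_ge t r with htr | htr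
  · have hsmall : ∑ i ∈ univ.filter (fun i => ¬ B < f i), min (f i) B =
        ∑ i ∈ univ.filter (fun i : Fin n => (i : ℕ) < n - t), f i := by
      refine sum_congr (filter_congr fun i _ => ?_) fun i hi => min_eq_left ?_
      · rw [not_lt, le_iff_val_lt_of_monotone hf]
      · exact (le_iff_val_lt_of_monotone hf B i).2 (mem_filter.1 hi).2
    linarith [hbound t htr]
  · have hnonneg : 0 ≤ ∑ i ∈ univ.filter (fun i => ¬ B < f i), min (f i) B :=
      sum_nonneg fun i _ => le_min (hf0 i) hB
    have : (r : ℝ) * B ≤ t * B := by gcongr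
    linarith

/-- Rüger's bound: for Bernoulli marginals `p i` with order statistics given by the
permutation `σ` (so that `p (σ 0) ≤ p (σ 1) ≤ …`), the maximum over all joint
distributions on `{0,1}^n` consistent with the marginals of the probability that the
sum of the coordinates is at least `r` equals
`min (min_{t ∈ {0,…,r-1}} ∑_{i=1}^{n-t} p_{(i)} / (r - t)) 1`. -/
theorem rueger_bound_tight (n r : ℕ) (hr1 : 1 ≤ r) (hrn : r ≤ n) (p : Fin n → ℝ)
    (hp : ∀ i, p i ∈ Set.Icc (0 : ℝ) 1) (σ : Equiv.Perm (Fin n))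
    (hσ : Monotone fun i => p (σ i)) :
    IsGreatest
      {P : ℝ | ∃ θ : (Fin n → Bool) → ℝ,
        (∀ c, 0 ≤ θ c) ∧ (∑ c, θ c) = 1 ∧
        (∀ i, ∑ c ∈ univ.filter (fun c : Fin n → Bool => c i = true), θ c = p i) ∧
        P = ∑ c ∈ univ.filter
            (fun c : Fin n → Bool => r ≤ (univ.filter (fun i => c i = true)).card), θ c}
      (min
        ((Finset.range r).inf' (Finset.nonempty_range_iff.mpr (by omega))
          (fun t => (∑ i ∈ univ.filter (fun i : Fin n => (i : ℕ) < n - t), p (σ i)) /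
            ((r : ℝ) - (t : ℝ))))
        1) := by
  have hpos : ∀ t ∈ range r, (0 : ℝ) < (r : ℝ) - t := fun t ht =>
    sub_pos.2 (by exact_mod_cast mem_range.1 ht)
  have hupper : ∀ θ : (Fin n → Bool) → ℝ, (∀ c, 0 ≤ θ c) → ∑ c, θ c = 1 →
      (∀ i, ∑ c ∈ univ.filter (fun c : Fin n → Bool => c i = true), θ c = p i) →
      ∑ c ∈ univ.filter
        (fun c : Fin n → Bool => r ≤ (univ.filter (fun i => c i = true)).card), θ c ≤
      min ((range r).inf' (nonempty_range_iff.mpr (by omega))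
        (fun t => (∑ i ∈ univ.filter (fun i : Fin n => (i : ℕ) < n - t), p (σ i)) /
          ((r : ℝ) - (t : ℝ)))) 1 := by
    intro θ hθ hθ1 hmarg
    refine le_min (le_inf' _ _ fun t ht => ?_) ?_
    · rw [le_div_iff₀ (hpos t ht)]
      have h := tail_mul_le_sum_marginals (r := r) hθ hmarg
        ((univ.filter fun i : Fin n => (i : ℕ) < n - t).map σ.toEmbedding)
        (t := t) (by
          have := card_compl_filter_val_lt n t
          rw [card_compl] at this ⊢
          rwa [card_map])
      simpa only [sum_map, Equiv.coe_toEmbedding] using h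
    · exact hθ1 ▸ sum_le_sum_of_subset_of_nonneg (subset_univ _) fun c _ _ => hθ c
  refine ⟨?_, fun P ⟨θ, hθ, hθ1, hmarg, hP⟩ => hP ▸ hupper θ hθ hθ1 hmarg⟩
  set B := min ((range r).inf' (nonempty_range_iff.mpr (by omega))
    (fun t => (∑ i ∈ univ.filter (fun i : Fin n => (i : ℕ) < n - t), p (σ i)) /
      ((r : ℝ) - (t : ℝ)))) 1
  have hB0 : 0 ≤ B := le_min (le_inf' _ _ fun t ht =>
    div_nonneg (sum_nonneg fun i _ => (hp _).1) (hpos t ht).le) zero_le_one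
  have hB1 : B ≤ 1 := min_le_right _ _
  have hsum : r * B ≤ ∑ i, min (p i) B := by
    rw [← Equiv.sum_comp σ]
    refine mul_le_sum_min hσ (fun i => (hp _).1) hB0 fun t ht => ?_
    rw [← le_div_iff₀ (hpos t (mem_range.2 ht))]
    exact (min_le_left _ _).trans (inf'_le _ (mem_range.2 ht))
  obtain ⟨w, hw, hw1, hwq, hwr⟩ := exists_measure_of_marginals r hB0
    (q := fun i => min (p i) B) (fun i => ⟨le_min (hp i).1 hB0, min_le_right _ _⟩) hsum
  have hrest : ∀ i, p i - min (p i) B ∈ Set.Icc 0 (1 - B) := fun i => by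
    have := (hp i).2
    rcases min_cases (p i) B with h | h <;> constructor <;> linarith
  obtain ⟨v, hv, hv1, hvq, -⟩ := exists_measure_of_marginals 0 (sub_nonneg.2 hB1)
    (q := fun i => p i - min (p i) B) hrest
    (by simpa using sum_nonneg fun i _ => (hrest i).1)
  have hθ : ∀ c, 0 ≤ w c + v c := fun c => add_nonneg (hw c) (hv c)
  have hθ1 : ∑ c, (w c + v c) = 1 := by rw [sum_add_distrib, hw1, hv1]; ring
  have hmarg : ∀ i, ∑ c ∈ univ.filter (fun c : Fin n → Bool => c i = true), (w c + v c) = p i :=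
    fun i => by rw [sum_add_distrib, hwq, hvq]; ring
  refine ⟨fun c => w c + v c, hθ, hθ1, hmarg, le_antisymm ?_ (hupper _ hθ hθ1 hmarg)⟩
  rw [sum_add_distrib, hwr]
  exact le_add_of_nonneg_right (sum_nonneg fun c _ => hv c)
end

section
/- Let n, K be positive integers, X a nonempty finite subset of {0,1}^n, and for each i ∈ [n] let p_{i0},…,p_{iK} be nonnegative reals summing to 1. Let Θ be the set of probability distributions θ on {0,…,K}^n with P_θ(c̃_i = k) = p_{ik} for all i, k, let Z(c) = max_{x∈X} cᵀx, and let r be a real number. Then the maximum over θ ∈ Θ of P_θ(Z(c̃) ≥ r) equals the infimum of λ + Σ_{i=1}^n Σ_{k=0}^K α_{ik} p_{ik} over all λ ∈ ℝ and α ∈ ℝ^{n×(K+1)} satisfying λ + Σ_{i=1}^n α_{i,c_i} ≥ 1 for every c ∈ {0,…,K}^n with Z(c) ≥ r, and λ + Σ_{i=1}^n α_{i,c_i} ≥ 0 for every c ∈ {0,…,K}^n (strong linear programming duality for the extremal probability bound). -/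
open Finset
open scoped Classical

/-- Strong duality for a linear program over the standard simplex: any value strictly above all
primal feasible values is the value of a dual feasible point. -/
theorem exists_dual_feasible_of_forall_lt {ι J : Type*} [Fintype ι] [Fintype J]
    (A : J → ι → ℝ) (w : ι → ℝ) (b : J → ℝ) (M : ℝ)
    (hne : ∃ θ ∈ stdSimplex ℝ ι, ∀ j, ∑ c, θ c * A j c = b j)
    (hM : ∀ θ ∈ stdSimplex ℝ ι, (∀ j, ∑ c, θ c * A j c = b j) → ∑ c, θ c * w c < M) :
    ∃ (lam : ℝ) (y : J → ℝ), (∀ c, w c ≤ lam + ∑ j, y j * A j c) ∧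
      lam + ∑ j, y j * b j = M := by
  let L : (ι → ℝ) →ₗ[ℝ] (J → ℝ) × ℝ :=
    { toFun := fun θ => (fun j => ∑ c, θ c * A j c, ∑ c, θ c * w c)
      map_add' := fun θ η => by
        ext <;> simp [add_mul, Finset.sum_add_distrib]
      map_smul' := fun a θ => by
        ext <;> simp [mul_assoc, Finset.mul_sum] }
  have hcompact : IsCompact (L '' stdSimplex ℝ ι) :=
    (isCompact_stdSimplex ℝ ι).image L.continuous_of_finiteDimensional
  have hnot : (b, M) ∉ L '' stdSimplex ℝ ι := by
    rintro ⟨θ, hθ, h⟩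
    have h1 : (fun j => ∑ c, θ c * A j c) = b := congrArg Prod.fst h
    have h2 : ∑ c, θ c * w c = M := congrArg Prod.snd h
    exact (hM θ hθ (congrFun h1)).ne h2
  obtain ⟨f, u, hfu, huf⟩ := geometric_hahn_banach_closed_point
    ((convex_stdSimplex ℝ ι).linear_image L) hcompact.isClosed hnot
  set β : J → ℝ := fun j => f (Pi.single j 1, 0) with hβ
  set γ : ℝ := f (0, 1) with hγ
  have hf : ∀ (m : J → ℝ) (t : ℝ), f (m, t) = ∑ j, m j * β j + t * γ := by
    intro m t
    have h : (m, t) = ∑ j, m j • ((Pi.single j 1, 0) : (J → ℝ) × ℝ) + t • (0, 1) := by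
      ext
      · simp [Prod.fst_sum, Finset.sum_apply, Pi.single_apply]
      · simp [Prod.snd_sum]
    rw [h, map_add, map_sum, map_smul]
    simp only [map_smul, smul_eq_mul, hβ, hγ]
  have hγpos : 0 < γ := by
    obtain ⟨θ, hθ, hb⟩ := hne
    have h1 := (hfu _ ⟨θ, hθ, rfl⟩).trans huf
    have h2 : L θ = (b, ∑ c, θ c * w c) := Prod.ext (funext hb) rfl
    rw [h2, hf, hf] at h1
    have h3 := hM θ hθ hb
    by_contra! h
    nlinarith
  refine ⟨M + (∑ j, b j * β j) / γ, fun j => -β j / γ, fun c => ?_, ?_⟩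
  · have h1 := (hfu _ ⟨Pi.single c 1, single_mem_stdSimplex ℝ c, rfl⟩).trans huf
    have h2 : L (Pi.single c 1) = (fun j => A j c, w c) := by
      ext <;> simp [L, Pi.single_apply]
    rw [h2, hf, hf] at h1
    have h3 : ∑ j, -β j / γ * A j c = -(∑ j, A j c * β j) / γ := by
      rw [← Finset.sum_neg_distrib, Finset.sum_div]
      exact Finset.sum_congr rfl fun j _ => by ring
    rw [h3]
    have h4 : M + (∑ j, b j * β j) / γ + -(∑ j, A j c * β j) / γ
        = (∑ j, b j * β j + M * γ - ∑ j, A j c * β j) / γ := by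
      field_simp
      ring
    rw [h4, le_div_iff₀ hγpos]
    linarith
  · have h3 : ∑ j, -β j / γ * b j = -((∑ j, b j * β j) / γ) := by
      rw [Finset.sum_div, ← Finset.sum_neg_distrib]
      exact Finset.sum_congr rfl fun j _ => by ring
    rw [h3]
    ring

/-- The product weights have the prescribed marginals. -/
theorem sum_filter_prod_eq_marginal {ι κ : Type*} [Fintype ι] [DecidableEq ι]
    [Fintype κ] [DecidableEq κ]
    (p : ι → κ → ℝ) (hp1 : ∀ i, ∑ k, p i k = 1) (i : ι) (k : κ) :
    ∑ c ∈ univ.filter (fun c : ι → κ => c i = k), ∏ j, p j (c j) = p i k := by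
  have hset : univ.filter (fun c : ι → κ => c i = k)
      = Fintype.piFinset (fun j => if j = i then {k} else univ) := by
    ext c
    simp only [mem_filter, mem_univ, true_and, Fintype.mem_piFinset]
    refine ⟨fun h j => ?_, fun h => by simpa using h i⟩
    split_ifs with hj
    · subst hj; simpa using h
    · simp
  rw [hset, ← Finset.prod_univ_sum, Finset.prod_eq_single i]
  · simp
  · intro j _ hj
    simp [hj, hp1]
  · simp

/-- Integrating a separable function against weights with given marginals. -/
theorem sum_mul_sum_eq_of_marginals {ι κ : Type*} [Fintype ι] [DecidableEq ι]
    [Fintype κ] [DecidableEq κ]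
    {p : ι → κ → ℝ} {θ : (ι → κ) → ℝ}
    (hθ : ∀ i k, ∑ c ∈ univ.filter (fun c : ι → κ => c i = k), θ c = p i k)
    (α : ι → κ → ℝ) :
    ∑ c, θ c * ∑ i, α i (c i) = ∑ i, ∑ k, α i k * p i k := by
  simp_rw [Finset.mul_sum]
  rw [Finset.sum_comm]
  refine Finset.sum_congr rfl fun i _ => ?_
  rw [← Finset.sum_fiberwise (s := univ) (g := fun c : ι → κ => c i)]
  refine Finset.sum_congr rfl fun k _ => ?_
  rw [← hθ, Finset.mul_sum]
  refine Finset.sum_congr rfl fun c hc => ?_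
  rw [(Finset.mem_filter.mp hc).2, mul_comm]

/-- Strong LP duality for the extremal probability bound: the maximum over all joint
distributions on `{0,…,K}^n` with the given marginals of the probability that
`Z(c̃) = max_{x ∈ X} c̃ᵀx` is at least `r` equals the infimum of
`λ + ∑ i ∑ k α i k * p i k` over all dual feasible `(λ, α)`. -/
theorem extremal_upper_bound_strong_duality (n K : ℕ) (hn : 0 < n) (hK : 0 < K)
    (X : Finset (Fin n → Bool)) (hX : X.Nonempty)
    (p : Fin n → Fin (K + 1) → ℝ) (hp0 : ∀ i k, 0 ≤ p i k) (hp1 : ∀ i, (∑ k, p i k) = 1)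
    (r : ℝ) :
    sSup {P : ℝ | ∃ θ : (Fin n → Fin (K + 1)) → ℝ,
        (∀ c, 0 ≤ θ c) ∧ (∑ c, θ c) = 1 ∧
        (∀ i k, ∑ c ∈ univ.filter (fun c : Fin n → Fin (K + 1) => c i = k), θ c = p i k) ∧
        P = ∑ c ∈ univ.filter (fun c : Fin n → Fin (K + 1) =>
              r ≤ X.sup' hX (fun x => ∑ i, if x i then ((c i : ℕ) : ℝ) else 0)), θ c}
    = sInf {V : ℝ | ∃ (lam : ℝ) (α : Fin n → Fin (K + 1) → ℝ),
        (∀ c : Fin n → Fin (K + 1),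
          r ≤ X.sup' hX (fun x => ∑ i, if x i then ((c i : ℕ) : ℝ) else 0) →
            1 ≤ lam + ∑ i, α i (c i)) ∧
        (∀ c : Fin n → Fin (K + 1), 0 ≤ lam + ∑ i, α i (c i)) ∧
        V = lam + ∑ i, ∑ k, α i k * p i k} := by
  set E : (Fin n → Fin (K + 1)) → Prop := fun c =>
    r ≤ X.sup' hX (fun x => ∑ i, if x i then ((c i : ℕ) : ℝ) else 0) with hE
  have hprod_sum : ∑ c : Fin n → Fin (K + 1), ∏ i, p i (c i) = 1 := by
    rw [← Fintype.piFinset_univ, ← Finset.prod_univ_sum]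
    simp [hp1]
  have hprod_nonneg : ∀ c : Fin n → Fin (K + 1), 0 ≤ ∏ i, p i (c i) :=
    fun c => Finset.prod_nonneg fun i _ => hp0 i (c i)
  have hprod_marginal := sum_filter_prod_eq_marginal p hp1
  apply le_antisymm
  · refine csSup_le ⟨_, fun c => ∏ i, p i (c i), hprod_nonneg, hprod_sum, hprod_marginal, rfl⟩ ?_
    rintro P ⟨θ, hθ0, hθ1, hθm, rfl⟩
    refine le_csInf ⟨_, 1, 0, by simp, by simp, rfl⟩ ?_
    rintro V ⟨lam, α, h1, h0, rfl⟩
    rw [← sum_mul_sum_eq_of_marginals hθm α, Finset.sum_filter]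
    calc ∑ c, (if E c then θ c else 0)
        ≤ ∑ c, θ c * (lam + ∑ i, α i (c i)) := by
          refine Finset.sum_le_sum fun c _ => ?_
          split_ifs with h
          · exact le_mul_of_one_le_right (hθ0 c) (h1 c h)
          · exact mul_nonneg (hθ0 c) (h0 c)
      _ = lam + ∑ c, θ c * ∑ i, α i (c i) := by
          simp_rw [mul_add, Finset.sum_add_distrib, ← Finset.sum_mul, hθ1, one_mul]
  · refine le_of_forall_gt_imp_ge_of_dense fun M hM => ?_
    have hmarg : ∀ (θ : (Fin n → Fin (K + 1)) → ℝ) (i : Fin n) (k : Fin (K + 1)),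
        ∑ c, θ c * (if c i = k then 1 else 0) = ∑ c ∈ univ.filter (fun c => c i = k), θ c := by
      intro θ i k
      simp [Finset.sum_filter]
    obtain ⟨lam, y, hy, hval⟩ := exists_dual_feasible_of_forall_lt
      (fun (j : Fin n × Fin (K + 1)) (c : Fin n → Fin (K + 1)) =>
        if c j.1 = j.2 then (1 : ℝ) else 0)
      (fun c => if E c then 1 else 0) (fun j => p j.1 j.2) M
      ⟨fun c => ∏ i, p i (c i), ⟨hprod_nonneg, hprod_sum⟩,
        fun j => (hmarg _ _ _).trans (hprod_marginal j.1 j.2)⟩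
      (fun θ hθ hθm => by
        refine hM.trans_le' (le_csSup ?_ ⟨θ, hθ.1, hθ.2,
          fun i k => (hmarg _ _ _).symm.trans (hθm (i, k)), ?_⟩)
        · refine ⟨1, ?_⟩
          rintro P ⟨η, hη0, hη1, -, rfl⟩
          rw [← hη1]
          exact Finset.sum_le_sum_of_subset_of_nonneg (Finset.filter_subset _ _)
            fun c _ _ => hη0 c
        · simp [Finset.sum_filter, hE])
    have hsep : ∀ c : Fin n → Fin (K + 1),
        ∑ j : Fin n × Fin (K + 1), y j * (if c j.1 = j.2 then (1 : ℝ) else 0)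
          = ∑ i, y (i, c i) := by
      intro c
      simp [Fintype.sum_prod_type]
    rw [← hval]
    refine csInf_le ?_ ⟨lam, fun i k => y (i, k), fun c hc => ?_, fun c => ?_, ?_⟩
    · refine ⟨0, ?_⟩
      rintro V ⟨lam, α, -, h0, rfl⟩
      have h := Finset.sum_nonneg fun c (_ : c ∈ univ) => mul_nonneg (hprod_nonneg c) (h0 c)
      simp_rw [mul_add, Finset.sum_add_distrib, ← Finset.sum_mul, hprod_sum, one_mul] at h
      rwa [sum_mul_sum_eq_of_marginals hprod_marginal α] at h
    · have h := hy c
      rwa [hsep, if_pos hc] at h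
    · have h := hy c
      rw [hsep] at h
      refine le_trans ?_ h
      split_ifs <;> norm_num
    · rw [Fintype.sum_prod_type]
end

section
/- Let n be a positive integer, p_1,…,p_n ∈ [0,1], and w_0, w_1,…,w_n ∈ ℝ. Let S(w,1) be the maximum of Σ_{l=0}^n w_l · P_θ(Σ_{i=1}^n c̃_i = l) over all joint distributions θ on {0,1}^n with P_θ(c̃_i = 1) = p_i. Then S(w,1) equals the optimal value of the linear program: maximize Σ_{l=0}^n τ_l w_l over nonnegative variables τ_l (l ∈ {0,…,n}) and δ_{li} (l ∈ {0,…,n}, i ∈ [n]) subject to: Σ_{l=0}^n τ_l = 1; Σ_{l=0}^n δ_{li} = p_i for all i ∈ [n]; δ_{li} ≤ τ_l for all i ∈ [n] and l ∈ {0,…,n}; and Σ_{i=1}^n δ_{li} = l·τ_l for all l ∈ {0,…,n}. -/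
open Finset

/-- Hypersimplex decomposition: a vector with entries in `[0, t]` and total `l * t` is the vector
of marginals of a nonnegative weight of total mass `t` on Boolean vectors with exactly `l` ones. -/
theorem exists_weight_card_eq {n l : ℕ} (hl : l ≤ n) {t : ℝ} (ht : 0 ≤ t) {x : Fin n → ℝ}
    (hx0 : ∀ i, 0 ≤ x i) (hxt : ∀ i, x i ≤ t) (hsum : ∑ i, x i = l * t) :
    ∃ θ : (Fin n → Bool) → ℝ, (∀ c, 0 ≤ θ c) ∧
      (∀ c, (univ.filter (fun i => c i = true)).card ≠ l → θ c = 0) ∧ ∑ c, θ c = t ∧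
      ∀ i, ∑ c ∈ univ.filter (fun c : Fin n → Bool => c i = true), θ c = x i := by
  rcases ht.eq_or_lt with rfl | ht
  · refine ⟨0, fun _ => le_rfl, fun _ _ => rfl, by simp, fun i => ?_⟩
    simpa using le_antisymm (hx0 i) (hxt i)
  have hcard : (univ.filter (fun j : Fin n => (j : ℕ) < l)).card = l := by
    rw [Fin.card_filter_val_lt, min_eq_right hl]
  have hcard' : ((univ.filter (fun j : Fin n => ¬ (j : ℕ) < l)).card : ℝ) = n - l := by
    have h := card_filter_add_card_filter_not (s := univ) (fun j : Fin n => (j : ℕ) < l)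
    rw [hcard, card_univ, Fintype.card_fin] at h
    exact eq_sub_of_add_eq' (by exact_mod_cast h)
  have hxl : l = 0 → ∀ i, x i = 0 := by
    rintro rfl i
    simp only [Nat.cast_zero, zero_mul] at hsum
    exact (sum_eq_zero_iff_of_nonneg fun i _ => hx0 i).1 hsum i (mem_univ i)
  have hxn : l = n → ∀ i, x i = t := by
    rintro rfl i
    have h : ∑ i, (t - x i) = 0 := by simp [sum_sub_distrib, hsum]
    linarith [(sum_eq_zero_iff_of_nonneg fun i _ => sub_nonneg.2 (hxt i)).1 h i (mem_univ i)]
  have hleft : ∀ i, (l : ℝ) * (x i / t / l) = x i / t := fun i => by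
    by_cases h : l = 0
    · simp [h, hxl h i]
    · field_simp
  have hright : ∀ i, ((n : ℝ) - l) * ((1 - x i / t) / (n - l)) = 1 - x i / t := fun i => by
    by_cases h : l = n
    · simp [h, hxn h i, ht.ne']
    · have : (n : ℝ) - l ≠ 0 := sub_ne_zero.2 (by exact_mod_cast Ne.symm h)
      field_simp
  let M : Matrix (Fin n) (Fin n) ℝ := fun i j =>
    if (j : ℕ) < l then x i / t / l else (1 - x i / t) / (n - l)
  have hM : M ∈ doublyStochastic ℝ (Fin n) := by
    rw [mem_doublyStochastic_iff_sum]
    refine ⟨fun i j => ?_, fun i => ?_, fun j => ?_⟩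
    · have h1 : 0 ≤ x i / t := div_nonneg (hx0 i) ht.le
      have h2 : x i / t ≤ 1 := (div_le_one ht).2 (hxt i)
      have h3 : (l : ℝ) ≤ n := by exact_mod_cast hl
      simp only [M]
      split_ifs
      · positivity
      · exact div_nonneg (by linarith) (by linarith)
    · simp only [M]
      rw [sum_ite, sum_const, sum_const, nsmul_eq_mul, nsmul_eq_mul, hcard, hcard', hleft,
        hright]
      ring
    · simp only [M]
      split_ifs with h
      · have : (l : ℝ) ≠ 0 := by
          have : l ≠ 0 := by omega
          exact_mod_cast this
        rw [← sum_div, ← sum_div, hsum]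
        field_simp
      · have : (n : ℝ) - l ≠ 0 := by
          have : n ≠ l := by omega
          exact sub_ne_zero.2 (by exact_mod_cast this)
        rw [← sum_div, sum_sub_distrib, ← sum_div, hsum]
        simp only [sum_const, card_univ, Fintype.card_fin, nsmul_eq_mul]
        field_simp
  obtain ⟨v, hv0, hv1, hvM⟩ := exists_eq_sum_perm_of_mem_doublyStochastic hM
  let C : Equiv.Perm (Fin n) → Fin n → Bool := fun σ i => decide ((σ i : ℕ) < l)
  refine ⟨fun c => t * ∑ σ ∈ univ.filter (fun σ => C σ = c), v σ,
    fun c => mul_nonneg ht.le (sum_nonneg fun σ _ => hv0 σ), fun c hc => ?_, ?_, fun i => ?_⟩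
  · beta_reduce
    rw [filter_false_of_mem, sum_empty, mul_zero]
    rintro σ - rfl
    apply hc
    simp only [C, decide_eq_true_eq]
    rw [← hcard]
    exact card_equiv σ (by simp [hcard])
  · rw [← mul_sum, sum_fiberwise, hv1, mul_one]
  · have hentry : ∀ j, M i j = ∑ σ, if σ i = j then v σ else 0 := fun j => by
      rw [← hvM, Matrix.sum_apply]
      refine sum_congr rfl fun σ _ => ?_
      simp [Equiv.Perm.permMatrix, PEquiv.toMatrix_apply, eq_comm]
    have hrow : ∑ j ∈ univ.filter (fun j : Fin n => (j : ℕ) < l), M i j = x i / t := by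
      rw [sum_congr rfl fun j hj => if_pos (mem_filter.1 hj).2, sum_const, hcard, nsmul_eq_mul,
        hleft]
    have hx : x i = t * (x i / t) := by field_simp
    rw [← mul_sum, hx, ← hrow]
    congr 1
    simp only [hentry]
    rw [sum_comm]
    simp only [sum_filter]
    rw [sum_congr rfl fun c _ => ite_sum_zero _ _ _, sum_comm]
    refine sum_congr rfl fun σ _ => ?_
    rw [sum_eq_single (C σ) (fun c _ hc => by simp [hc.symm]) (by simp),
      sum_eq_single (σ i) (fun j _ hj => by simp [hj.symm]) (by simp)]
    simp [C]

/-- Compact LP for the tightest weighted probability bound for sums of Bernoulli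
random variables: `S(w,1) = max_θ ∑_{l=0}^n w l · P_θ(∑ c̃ = l)` equals the optimal
value of the stated linear program in the variables `τ l` (`l ∈ {0,…,n}`) and
`δ l i` (`l ∈ {0,…,n}`, `i ∈ [n]`). -/
theorem weighted_bernoulli_sum_compact_LP (n : ℕ) (hn : 0 < n)
    (p : Fin n → ℝ) (hp : ∀ i, p i ∈ Set.Icc (0 : ℝ) 1) (w : ℕ → ℝ) :
    sSup {P : ℝ | ∃ θ : (Fin n → Bool) → ℝ,
        (∀ c, 0 ≤ θ c) ∧ (∑ c, θ c) = 1 ∧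
        (∀ i, ∑ c ∈ univ.filter (fun c : Fin n → Bool => c i = true), θ c = p i) ∧
        P = ∑ l ∈ Finset.range (n + 1), w l *
              ∑ c ∈ univ.filter (fun c : Fin n → Bool =>
                (univ.filter (fun i => c i = true)).card = l), θ c}
    = sSup {V : ℝ | ∃ (τ : ℕ → ℝ) (δ : ℕ → Fin n → ℝ),
        (∀ l, 0 ≤ τ l) ∧ (∀ l i, 0 ≤ δ l i) ∧
        (∑ l ∈ Finset.range (n + 1), τ l) = 1 ∧
        (∀ i, (∑ l ∈ Finset.range (n + 1), δ l i) = p i) ∧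
        (∀ i, ∀ l ∈ Finset.range (n + 1), δ l i ≤ τ l) ∧
        (∀ l ∈ Finset.range (n + 1), (∑ i, δ l i) = (l : ℝ) * τ l) ∧
        V = ∑ l ∈ Finset.range (n + 1), τ l * w l} := by
  have hcard_mem : ∀ c : Fin n → Bool,
      (univ.filter (fun i => c i = true)).card ∈ range (n + 1) := fun c => by
    rw [mem_range, Nat.lt_succ_iff]
    simpa using card_le_univ (univ.filter (fun i => c i = true))
  congr 1
  ext V
  constructor
  · rintro ⟨θ, h0, h1, hm, rfl⟩
    refine ⟨fun l => ∑ c ∈ univ.filter (fun c : Fin n → Bool =>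
          (univ.filter (fun i => c i = true)).card = l), θ c,
      fun l i => ∑ c ∈ univ.filter (fun c : Fin n → Bool =>
          (univ.filter (fun i => c i = true)).card = l), if c i = true then θ c else 0,
      fun l => sum_nonneg fun c _ => h0 c, fun l i => sum_nonneg fun c _ => ?_, ?_, fun i => ?_,
      fun i l _ => sum_le_sum fun c _ => ?_, fun l _ => ?_, ?_⟩
    · split_ifs
      exacts [h0 c, le_rfl]
    · rw [sum_fiberwise_of_maps_to fun c _ => hcard_mem c, h1]
    · rw [sum_fiberwise_of_maps_to fun c _ => hcard_mem c, ← sum_filter, hm]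
    · split_ifs
      exacts [le_rfl, h0 c]
    · rw [sum_comm, mul_sum]
      refine sum_congr rfl fun c hc => ?_
      rw [← sum_filter, sum_const, (mem_filter.1 hc).2, nsmul_eq_mul]
    · exact sum_congr rfl fun l _ => mul_comm _ _
  · rintro ⟨τ, δ, hτ, hδ, h1, hp', hle, hsum, rfl⟩
    have hex : ∀ l, ∃ θ : (Fin n → Bool) → ℝ, l ∈ range (n + 1) → (∀ c, 0 ≤ θ c) ∧
        (∀ c, (univ.filter (fun i => c i = true)).card ≠ l → θ c = 0) ∧ ∑ c, θ c = τ l ∧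
        ∀ i, ∑ c ∈ univ.filter (fun c : Fin n → Bool => c i = true), θ c = δ l i := fun l => by
      by_cases hl : l ∈ range (n + 1)
      · obtain ⟨θ, hθ⟩ := exists_weight_card_eq (Nat.lt_succ_iff.1 (mem_range.1 hl)) (hτ l) (hδ l)
          (fun i => hle i l hl) (hsum l hl)
        exact ⟨θ, fun _ => hθ⟩
      · exact ⟨0, fun h => absurd h hl⟩
    choose θ hθ using hex
    refine ⟨fun c => ∑ l ∈ range (n + 1), θ l c, fun c => sum_nonneg fun l hl => (hθ l hl).1 c,
      ?_, fun i => ?_, sum_congr rfl fun l hl => ?_⟩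
    · rw [sum_comm, ← h1]
      exact sum_congr rfl fun l hl => (hθ l hl).2.2.1
    · rw [sum_comm, ← hp' i]
      exact sum_congr rfl fun l hl => (hθ l hl).2.2.2 i
    · rw [mul_comm, ← (hθ l hl).2.2.1, sum_filter]
      congr 1
      refine sum_congr rfl fun c _ => ?_
      split_ifs with hc
      · rw [sum_eq_single_of_mem l hl fun k hk hkl => (hθ k hk).2.1 c (hc ▸ hkl.symm)]
      · exact (hθ l hl).2.1 c hc
end

section
/- Let G = (V, E) be a finite directed acyclic graph with source s and sink t admitting at least one s–t path, K a positive integer, r an integer, and α ∈ ℝ^{E×(K+1)} edge-assignment costs. Set q_{ij} = min_{k∈{0,…,K}} α_{ij,k} and v_{ij,k} = α_{ij,k} − q_{ij} ≥ 0. Then Sep(α) := min{ Σ_{(i,j)∈E} α_{ij,c_{ij}} : c ∈ {0,…,K}^E, Z^pert(c) ≥ r } satisfies Sep(α) = Σ_{(i,j)∈E} q_{ij} + min over directed s–t paths P and assignments (k_e ∈ {0,…,K})_{e∈P} with Σ_{e∈P} k_e ≥ r of Σ_{e∈P} v_{e,k_e}, provided the feasible set is nonempty (intervals interpreted in the extended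 reals otherwise). -/
open Finset
open scoped Classical

/-- `P` is a directed path from `s` to `t` in the directed graph with edge set `E`,
represented as the list of its edges. -/
def IsDipath {V : Type*} (E : Finset (V × V)) (s t : V) (P : List (V × V)) : Prop :=
  (∀ e ∈ P, e ∈ E) ∧ List.Chain' (fun e f => e.2 = f.1) P ∧
    ((P = [] ∧ s = t) ∨
      ((P.map Prod.fst).head? = some s ∧ (P.map Prod.snd).getLast? = some t ∧
        (P.map Prod.fst).Nodup ∧ t ∉ P.map Prod.fst))

theorem IsDipath.nodup {V : Type*} {E : Finset (V × V)} {s t : V} {P : List (V × V)}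
    (h : IsDipath E s t P) : P.Nodup := by
  obtain ⟨-, -, ⟨rfl, -⟩ | ⟨-, -, h, -⟩⟩ := h
  · exact List.nodup_nil
  · exact List.Nodup.of_map _ h

theorem IsDipath.sum_map_eq {V : Type*} [DecidableEq V] {E : Finset (V × V)}
    {s t : V} {P : List (V × V)} (h : IsDipath E s t P) (f : V × V → ℝ) :
    (P.map f).sum = ∑ e ∈ P.toFinset, f e :=
  (List.sum_toFinset f h.nodup).symm

theorem IsDipath.toFinset_subset {V : Type*} [DecidableEq V] {E : Finset (V × V)}
    {s t : V} {P : List (V × V)} (h : IsDipath E s t P) : P.toFinset ⊆ E :=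
  fun e he => h.1 e (List.mem_toFinset.1 he)

/-- Decomposition of the PERT separation problem: with `q e = min_k α e k` and the
shifted costs `v e k = α e k - q e ≥ 0`,
`Sep(α) = min { ∑_{e ∈ E} α e (c e) : c ∈ {0,…,K}^E, Z^pert(c) ≥ r }` equals
`∑_{e ∈ E} q e` plus the minimum, over `s`–`t` paths `P` and assignments of levels
`k e ∈ {0,…,K}` to the edges of `P` with `∑_{e ∈ P} k e ≥ r`, of
`∑_{e ∈ P} v e (k e)` (infima taken in the extended reals if infeasible). -/
theorem pert_separation_decomposition {V : Type*} [Fintype V] [DecidableEq V]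
    (E : Finset (V × V)) (s t : V) (hst : s ≠ t)
    (ord : V → ℕ) (hord : ∀ e ∈ E, ord e.1 < ord e.2)
    (hpath : ∃ P : List (V × V), IsDipath E s t P)
    (K : ℕ) (hK : 0 < K) (r : ℤ)
    (α : V × V → Fin (K + 1) → ℝ)
    (q : V × V → ℝ)
    (hq : ∀ e, q e = (univ : Finset (Fin (K + 1))).inf' Finset.univ_nonempty (α e))
    (v : V × V → Fin (K + 1) → ℝ) (hv : ∀ e k, v e k = α e k - q e) :
    sInf {w : EReal | ∃ c : V × V → Fin (K + 1),
        (∃ P : List (V × V), IsDipath E s t P ∧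
          r ≤ (P.map fun e => ((c e : ℕ) : ℤ)).sum) ∧
        w = ((∑ e ∈ E, α e (c e) : ℝ) : EReal)}
    = ((∑ e ∈ E, q e : ℝ) : EReal)
      + sInf {w : EReal | ∃ (P : List (V × V)) (k : V × V → Fin (K + 1)),
          IsDipath E s t P ∧
          r ≤ (P.map fun e => ((k e : ℕ) : ℤ)).sum ∧
          w = (((P.map fun e => v e (k e)).sum : ℝ) : EReal)} := by
  have hv_nonneg : ∀ e k, 0 ≤ v e k := fun e k => by
    rw [hv, hq, sub_nonneg]
    exact Finset.inf'_le _ (mem_univ k)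
  have hv_zero : ∀ e, ∃ k, v e k = 0 := fun e => by
    obtain ⟨k, -, hk⟩ :=
      Finset.exists_mem_eq_inf' (univ_nonempty (α := Fin (K + 1))) (α e)
    exact ⟨k, by rw [hv, hq, hk, sub_self]⟩
  have hsplit : ∀ c : V × V → Fin (K + 1),
      ∑ e ∈ E, α e (c e) = ∑ e ∈ E, q e + ∑ e ∈ E, v e (c e) := fun c => by
    rw [← Finset.sum_add_distrib]
    exact Finset.sum_congr rfl fun e _ => by rw [hv]; ring
  choose m hm using hv_zero
  apply le_antisymm
  · rw [add_comm (Real.toEReal _), ← EReal.sub_le_iff_le_add (.inl (EReal.coe_ne_bot _))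
      (.inl (EReal.coe_ne_top _))]
    refine le_sInf ?_
    rintro _ ⟨P, k, hP, hr, rfl⟩
    refine EReal.sub_le_of_le_add' ?_
    refine sInf_le ⟨fun e => if e ∈ P then k e else m e, ⟨P, hP, ?_⟩, ?_⟩
    · convert hr using 2
      exact List.map_congr_left fun e he => by simp [he]
    · rw [hsplit, ← EReal.coe_add, hP.sum_map_eq]
      congr 2
      refine Finset.sum_subset_zero_on_sdiff hP.toFinset_subset (fun e he => ?_) fun e he => ?_
      · have he' : e ∉ P := fun h => (Finset.mem_sdiff.1 he).2 (List.mem_toFinset.2 h)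
        simp [he', hm]
      · simp [List.mem_toFinset.1 he]
  · refine le_sInf ?_
    rintro _ ⟨c, ⟨P, hP, hr⟩, rfl⟩
    rw [hsplit, EReal.coe_add]
    refine add_le_add le_rfl (sInf_le_of_le ⟨P, c, hP, hr, rfl⟩ ?_)
    rw [EReal.coe_le_coe_iff, hP.sum_map_eq]
    exact Finset.sum_le_sum_of_subset_of_nonneg hP.toFinset_subset
      fun e _ _ => hv_nonneg e (c e)
end
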